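/- For any ε ∈ (0,1), with probability at least 1 − ε one has ‖Δ‖₂ ≤ √( d · log(2d/ε) / T ), where ‖·‖₂ denotes the Euclidean norm on ℝ^d. -/

import Mathlib

open MeasureTheory Finset
open scoped RealInnerProductSpace ENNReal

/-- Hoeffding's lemma for a centred Bernoulli variable. -/
lemma bernoulli_hoeffding (p x : ℝ) (hp0 : 0 ≤ p) (hp1 : p ≤ 1) :
    (1 - p) * Real.exp (x * p) + p * Real.exp (x * (p - 1)) ≤ Real.exp (x ^ 2 / 8) := by
  let ν : Measure ℝ :=
    ENNReal.ofReal (1 - p) • Measure.dirac p + ENNReal.ofReal p • Measure.dirac (p - 1)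
  have hint : ∀ f : ℝ → ℝ, ∫ z, f z ∂ν = (1 - p) * f p + p * f (p - 1) := by
    intro f
    have h1 : ∀ a : ℝ, Integrable f (Measure.dirac a) := fun a =>
      integrable_dirac (by simp)
    rw [integral_add_measure ((h1 _).smul_measure ENNReal.ofReal_ne_top)
      ((h1 _).smul_measure ENNReal.ofReal_ne_top), integral_smul_measure, integral_smul_measure,
      integral_dirac, integral_dirac, ENNReal.toReal_ofReal (by linarith),
      ENNReal.toReal_ofReal hp0]
    simp
  haveI : IsProbabilityMeasure ν := by
    constructor
    simp only [ν, Measure.add_apply, Measure.smul_apply, measure_univ, smul_eq_mul, mul_one]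
    rw [← ENNReal.ofReal_add (by linarith) hp0]
    simp
  have hb : ∀ᵐ z ∂ν, z ∈ Set.Icc (p - 1) p := by
    rw [ae_add_measure_iff]
    constructor
    · apply Measure.ae_smul_measure
      refine (ae_dirac_iff (p := fun z => z ∈ Set.Icc (p - 1) p) measurableSet_Icc).2 ?_
      exact ⟨by linarith, le_rfl⟩
    · apply Measure.ae_smul_measure
      refine (ae_dirac_iff (p := fun z => z ∈ Set.Icc (p - 1) p) measurableSet_Icc).2 ?_
      exact ⟨le_rfl, by linarith⟩
  have h := ProbabilityTheory.hasSubgaussianMGF_of_mem_Icc_of_integral_eq_zero (μ := ν)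
    (X := fun z => z) (a := p - 1) (b := p) aemeasurable_id hb (by rw [hint]; ring)
  have h2 := h.mgf_le x
  rw [ProbabilityTheory.mgf, hint] at h2
  refine h2.trans (le_of_eq ?_)
  congr 1
  simp
  ring

lemma mgf_step {Ω : Type*} {m m0 : MeasurableSpace Ω} {μ : Measure Ω} [IsProbabilityMeasure μ]
    (hm : m ≤ m0) (M x q y : Ω → ℝ) (C L : ℝ)
    (hM : Measurable[m] M) (hx : Measurable[m] x) (hq : Measurable[m] q) (hy : Measurable y)
    (hM0 : ∀ ω, 0 ≤ M ω) (hMC : ∀ ω, M ω ≤ C) (hxL : ∀ ω, |x ω| ≤ L)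
    (hq01 : ∀ ω, q ω ∈ Set.Icc (0 : ℝ) 1) (hy01 : ∀ ω, y ω = 0 ∨ y ω = 1)
    (hc : μ[y | m] =ᵐ[μ] q) :
    ∫ ω, M ω * Real.exp (x ω * (q ω - y ω)) ∂μ ≤ Real.exp (L ^ 2 / 8) * ∫ ω, M ω ∂μ := by
  let A : Ω → ℝ := fun ω => M ω * Real.exp (x ω * q ω)
  let B : Ω → ℝ := fun ω => M ω * (Real.exp (x ω * (q ω - 1)) - Real.exp (x ω * q ω))
  have hA : Measurable[m] A := hM.mul (hx.mul hq).exp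
  have hB : Measurable[m] B := hM.mul ((hx.mul (hq.sub measurable_const)).exp.sub (hx.mul hq).exp)
  have e1 : ∀ ω, Real.exp (x ω * q ω) ≤ Real.exp L := fun ω => by
    have h1 := abs_le.1 (hxL ω)
    obtain ⟨h2, h3⟩ := hq01 ω
    apply Real.exp_le_exp.2
    nlinarith
  have e2 : ∀ ω, Real.exp (x ω * (q ω - 1)) ≤ Real.exp L := fun ω => by
    have h1 := abs_le.1 (hxL ω)
    obtain ⟨h2, h3⟩ := hq01 ω
    apply Real.exp_le_exp.2
    nlinarith
  have iM : Integrable M μ := Integrable.of_bound (hM.mono hm le_rfl).aestronglyMeasurable C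
    (ae_of_all _ fun ω => by rw [Real.norm_eq_abs, abs_of_nonneg (hM0 ω)]; exact hMC ω)
  have iA : Integrable A μ := Integrable.of_bound (hA.mono hm le_rfl).aestronglyMeasurable
    (C * Real.exp L) (ae_of_all _ fun ω => by
      rw [Real.norm_eq_abs, abs_of_nonneg (mul_nonneg (hM0 ω) (Real.exp_pos _).le)]
      exact mul_le_mul (hMC ω) (e1 ω) (Real.exp_pos _).le ((hM0 ω).trans (hMC ω)))
  have bB : ∀ ω, |B ω| ≤ C * Real.exp L := fun ω => by
    simp only [B]
    rw [abs_mul, abs_of_nonneg (hM0 ω)]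
    refine mul_le_mul (hMC ω) ?_ (abs_nonneg _) ((hM0 ω).trans (hMC ω))
    rw [abs_le]
    constructor <;> linarith [e1 ω, e2 ω, Real.exp_pos (x ω * q ω), Real.exp_pos (x ω * (q ω - 1))]
  have by1 : ∀ ω, |y ω| ≤ 1 := fun ω => by rcases hy01 ω with h | h <;> simp [h]
  have iy : Integrable y μ := Integrable.of_bound hy.aestronglyMeasurable 1
    (ae_of_all _ by1)
  have iBy : Integrable (B * y) μ :=
    iy.bdd_mul (hB.mono hm le_rfl).aestronglyMeasurable (ae_of_all _ bB)
  have iBq : Integrable (B * q) μ := by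
    have iq : Integrable q μ := integrable_condExp.congr hc
    exact iq.bdd_mul (hB.mono hm le_rfl).aestronglyMeasurable (ae_of_all _ bB)
  have hpull : ∫ ω, (B * y) ω ∂μ = ∫ ω, (B * q) ω ∂μ := by
    rw [← integral_condExp hm]
    apply integral_congr_ae
    refine (condExp_mul_of_stronglyMeasurable_left hB.stronglyMeasurable iBy iy).trans ?_
    filter_upwards [hc] with ω h
    simp [h]
  have heq : ∀ ω, M ω * Real.exp (x ω * (q ω - y ω)) = A ω + (B * y) ω := fun ω => by
    rcases hy01 ω with h | h <;> simp [A, B, h] <;> ring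
  calc ∫ ω, M ω * Real.exp (x ω * (q ω - y ω)) ∂μ = ∫ ω, (A ω + (B * y) ω) ∂μ := by
        simp_rw [heq]
    _ = ∫ ω, (A ω + (B * q) ω) ∂μ := by
        rw [integral_add iA iBy, hpull, integral_add iA iBq]
    _ ≤ ∫ ω, Real.exp (L ^ 2 / 8) * M ω ∂μ := by
        apply integral_mono (iA.add iBq) (iM.const_mul _)
        intro ω
        have h1 := bernoulli_hoeffding (q ω) (x ω) (hq01 ω).1 (hq01 ω).2
        have h2 : Real.exp (x ω ^ 2 / 8) ≤ Real.exp (L ^ 2 / 8) := by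
          apply Real.exp_le_exp.2
          have := sq_le_sq' (abs_le.1 (hxL ω)).1 (abs_le.1 (hxL ω)).2
          linarith
        have h3 := mul_le_mul_of_nonneg_left (h1.trans h2) (hM0 ω)
        simp only [A, B, Pi.add_apply, Pi.mul_apply]
        nlinarith
    _ = _ := integral_const_mul _ _

lemma mgf_sum {Ω : Type*} {m0 : MeasurableSpace Ω} {μ : Measure Ω} [IsProbabilityMeasure μ]
    (T : ℕ) (ℱ : Filtration ℕ m0) (x q y : ℕ → Ω → ℝ) (L : ℝ)
    (hx : ∀ t ∈ Finset.Icc 1 T, Measurable[ℱ (t - 1)] (x t))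
    (hq : ∀ t ∈ Finset.Icc 1 T, Measurable[ℱ (t - 1)] (q t))
    (hy : ∀ t ∈ Finset.Icc 1 T, Measurable[ℱ t] (y t))
    (hxL : ∀ t ∈ Finset.Icc 1 T, ∀ ω, |x t ω| ≤ L)
    (hq01 : ∀ t ∈ Finset.Icc 1 T, ∀ ω, q t ω ∈ Set.Icc (0 : ℝ) 1)
    (hy01 : ∀ t ∈ Finset.Icc 1 T, ∀ ω, y t ω = 0 ∨ y t ω = 1)
    (hc : ∀ t ∈ Finset.Icc 1 T, μ[y t | ℱ (t - 1)] =ᵐ[μ] q t) (n : ℕ) (hn : n ≤ T) :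
    Measurable[ℱ n] (fun ω => ∑ t ∈ Finset.Icc 1 n, x t ω * (q t ω - y t ω)) ∧
    (∀ ω, ∑ t ∈ Finset.Icc 1 n, x t ω * (q t ω - y t ω) ≤ n * L) ∧
    ∫ ω, Real.exp (∑ t ∈ Finset.Icc 1 n, x t ω * (q t ω - y t ω)) ∂μ ≤
      Real.exp (n * (L ^ 2 / 8)) := by
  induction n with
  | zero => simp
  | succ n ih =>
    obtain ⟨h1, h2, h3⟩ := ih (by omega)
    have hmem : n + 1 ∈ Finset.Icc 1 T := by simp; omega
    have hx' := hx _ hmem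
    have hq' := hq _ hmem
    rw [Nat.add_sub_cancel] at hx' hq'
    have hc' := hc _ hmem
    rw [Nat.add_sub_cancel] at hc'
    simp_rw [Finset.sum_Icc_succ_top (Nat.le_add_left 1 n)]
    have hle : ℱ n ≤ ℱ (n + 1) := ℱ.mono (Nat.le_succ n)
    refine ⟨?_, ?_, ?_⟩
    · exact (h1.mono hle le_rfl).add
        ((hx'.mono hle le_rfl).mul ((hq'.mono hle le_rfl).sub (hy _ hmem)))
    · intro ω
      have a1 := h2 ω
      have a2 := abs_le.1 (hxL _ hmem ω)
      obtain ⟨a3, a4⟩ := hq01 _ hmem ω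
      have : x (n + 1) ω * (q (n + 1) ω - y (n + 1) ω) ≤ L := by
        rcases hy01 _ hmem ω with h | h <;> rw [h] <;> nlinarith
      push_cast
      linarith
    · simp_rw [Real.exp_add]
      refine (mgf_step (ℱ.le n) _ _ _ _ (Real.exp (n * L)) L h1.exp hx' hq'
        ((hy _ hmem).mono (ℱ.le _) le_rfl) (fun ω => (Real.exp_pos _).le)
        (fun ω => Real.exp_le_exp.2 (h2 ω)) (hxL _ hmem) (hq01 _ hmem) (hy01 _ hmem) hc').trans ?_
      refine (mul_le_mul_of_nonneg_left h3 (Real.exp_pos _).le).trans (le_of_eq ?_)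
      rw [← Real.exp_add]
      congr 1
      push_cast
      ring

lemma tail_bound {Ω : Type*} {m0 : MeasurableSpace Ω} {μ : Measure Ω} [IsProbabilityMeasure μ]
    (T : ℕ) (hT : 1 ≤ T) (ℱ : Filtration ℕ m0) (x q y : ℕ → Ω → ℝ)
    (hx : ∀ t ∈ Finset.Icc 1 T, Measurable[ℱ (t - 1)] (x t))
    (hq : ∀ t ∈ Finset.Icc 1 T, Measurable[ℱ (t - 1)] (q t))
    (hy : ∀ t ∈ Finset.Icc 1 T, Measurable[ℱ t] (y t))
    (hxL : ∀ t ∈ Finset.Icc 1 T, ∀ ω, |x t ω| ≤ 1)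
    (hq01 : ∀ t ∈ Finset.Icc 1 T, ∀ ω, q t ω ∈ Set.Icc (0 : ℝ) 1)
    (hy01 : ∀ t ∈ Finset.Icc 1 T, ∀ ω, y t ω = 0 ∨ y t ω = 1)
    (hc : ∀ t ∈ Finset.Icc 1 T, μ[y t | ℱ (t - 1)] =ᵐ[μ] q t) (l : ℝ) (hl : 0 ≤ l) :
    μ {ω | Real.sqrt (T * l) ≤ ∑ t ∈ Finset.Icc 1 T, x t ω * (q t ω - y t ω)} ≤
      ENNReal.ofReal (Real.exp (-l)) := by
  have hT0 : (0 : ℝ) < T := by exact_mod_cast hT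
  set s := Real.sqrt (T * l) with hs
  have hss : s ^ 2 = T * l := Real.sq_sqrt (by positivity)
  have hs0 : 0 ≤ s := Real.sqrt_nonneg _
  let c : ℝ := 2 * s / T
  have hc0 : 0 ≤ c := by positivity
  obtain ⟨h1, h2, h3⟩ := mgf_sum T ℱ (fun t ω => c * x t ω) q y c
    (fun t ht => (hx t ht).const_mul c) hq hy
    (fun t ht ω => by
      rw [abs_mul, abs_of_nonneg hc0]
      exact mul_le_of_le_one_right hc0 (hxL t ht ω)) hq01 hy01 hc T le_rfl
  have hsum : ∀ ω, ∑ t ∈ Finset.Icc 1 T, c * x t ω * (q t ω - y t ω) =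
      c * ∑ t ∈ Finset.Icc 1 T, x t ω * (q t ω - y t ω) := fun ω => by
    rw [Finset.mul_sum]; simp_rw [mul_assoc]
  simp_rw [hsum] at h1 h2 h3
  have hint : Integrable (fun ω => Real.exp (c * ∑ t ∈ Finset.Icc 1 T, x t ω * (q t ω - y t ω))) μ :=
    Integrable.of_bound (h1.mono (ℱ.le _) le_rfl).exp.aestronglyMeasurable (Real.exp (T * c))
      (ae_of_all _ fun ω => by
        rw [Real.norm_eq_abs, abs_of_pos (Real.exp_pos _)]
        exact Real.exp_le_exp.2 (h2 ω))
  have h4 := ProbabilityTheory.measure_ge_le_exp_mul_mgf s hc0 hint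
  rw [← ofReal_measureReal (measure_ne_top _ _)]
  apply ENNReal.ofReal_le_ofReal
  refine h4.trans ((mul_le_mul_of_nonneg_left h3 (Real.exp_pos _).le).trans ?_)
  rw [← Real.exp_add]
  apply Real.exp_le_exp.2
  have e : -c * s + T * (c ^ 2 / 8) = - (3 / 2) * (s ^ 2 / T) := by
    simp only [c]; field_simp; ring
  rw [e, hss, mul_div_cancel_left₀ _ hT0.ne']
  linarith

/-- With probability at least `1 − ε`,
`‖Δ‖₂ ≤ √(d·log(2d/ε)/T)`, where `Δ = (1/T) ∑ₜ ξₜ`,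
`ξₜ = wₜ (g(⟪wₜ, θ⋆⟫) − yₜ)`, and `‖·‖₂` is the Euclidean norm. -/
theorem delta_l2_norm_bound
    {Ω : Type*} {m0 : MeasurableSpace Ω} {μ : Measure Ω} [IsProbabilityMeasure μ]
    (T d : ℕ) (hT : 1 ≤ T) (hd : 1 ≤ d)
    (ℱ : Filtration ℕ m0)
    (w : ℕ → Ω → EuclideanSpace ℝ (Fin d))
    (y : ℕ → Ω → ℝ)
    (hw_meas : ∀ t ∈ Finset.Icc 1 T, Measurable[ℱ (t - 1)] (w t))
    (hw_range : ∀ t ∈ Finset.Icc 1 T, ∀ ω i, w t ω i ∈ Set.Icc (0 : ℝ) 1)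
    (hy_meas : ∀ t ∈ Finset.Icc 1 T, Measurable[ℱ t] (y t))
    (hy_range : ∀ t ∈ Finset.Icc 1 T, ∀ ω, y t ω = 0 ∨ y t ω = 1)
    (g : ℝ → ℝ) (hg_range : ∀ x, g x ∈ Set.Icc (0 : ℝ) 1)
    (θstar : EuclideanSpace ℝ (Fin d))
    (hcond : ∀ t ∈ Finset.Icc 1 T,
      μ[y t | ℱ (t - 1)] =ᵐ[μ] fun ω => g ⟪w t ω, θstar⟫)
    (Δ : Ω → EuclideanSpace ℝ (Fin d))
    (hΔ : ∀ ω, Δ ω =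
      (T : ℝ)⁻¹ • ∑ t ∈ Finset.Icc 1 T, (g ⟪w t ω, θstar⟫ - y t ω) • w t ω) :
    ∀ ε ∈ Set.Ioo (0 : ℝ) 1,
      ENNReal.ofReal (1 - ε) ≤
        μ {ω | ‖Δ ω‖ ≤ Real.sqrt (d * Real.log (2 * d / ε) / T)} := by
  rintro ε ⟨hε0, hε1⟩
  have hT0 : (0 : ℝ) < T := by exact_mod_cast hT
  have hd1 : (1 : ℝ) ≤ d := by exact_mod_cast hd
  set l := Real.log (2 * d / ε) with hl
  have hl0 : 0 ≤ l := Real.log_nonneg (by rw [le_div_iff₀ hε0]; linarith)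
  have hexp : Real.exp (-l) = ε / (2 * d) := by
    rw [Real.exp_neg, hl, Real.exp_log (by positivity), inv_div]
  let q : ℕ → Ω → ℝ := fun t ω => max 0 (min (μ[y t | ℱ (t - 1)] ω) 1)
  have hq : ∀ t ∈ Finset.Icc 1 T, Measurable[ℱ (t - 1)] (q t) := fun t _ =>
    measurable_const.max (stronglyMeasurable_condExp.measurable.min measurable_const)
  have hq01 : ∀ t ∈ Finset.Icc 1 T, ∀ ω, q t ω ∈ Set.Icc (0 : ℝ) 1 := fun t _ ω =>
    ⟨le_max_left _ _, max_le zero_le_one (min_le_right _ _)⟩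
  have hqg : ∀ t ∈ Finset.Icc 1 T, ∀ᵐ ω ∂μ, q t ω = g ⟪w t ω, θstar⟫ := fun t ht => by
    filter_upwards [hcond t ht] with ω h
    simp only [q]
    rw [h, min_eq_left (hg_range _).2, max_eq_right (hg_range _).1]
  have hc : ∀ t ∈ Finset.Icc 1 T, μ[y t | ℱ (t - 1)] =ᵐ[μ] q t := fun t ht => by
    filter_upwards [hcond t ht, hqg t ht] with ω h h'
    rw [h, h']
  have hwi : ∀ t ∈ Finset.Icc 1 T, ∀ i, Measurable[ℱ (t - 1)] (fun ω => w t ω i) :=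
    fun t ht i => (by fun_prop : Measurable (fun v : EuclideanSpace ℝ (Fin d) => v i)).comp
      (hw_meas t ht)
  have hwb : ∀ t ∈ Finset.Icc 1 T, ∀ i ω, |w t ω i| ≤ 1 := fun t ht i ω => by
    rw [abs_of_nonneg (hw_range t ht ω i).1]; exact (hw_range t ht ω i).2
  let S : Fin d → Ω → ℝ := fun i ω => ∑ t ∈ Finset.Icc 1 T, w t ω i * (q t ω - y t ω)
  let s := Real.sqrt (T * l)
  have hss : s ^ 2 = T * l := Real.sq_sqrt (by positivity)
  have hs0 : 0 ≤ s := Real.sqrt_nonneg _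
  have hup : ∀ i, μ {ω | s ≤ S i ω} ≤ ENNReal.ofReal (Real.exp (-l)) := fun i =>
    tail_bound T hT ℱ (fun t ω => w t ω i) q y (fun t ht => hwi t ht i) hq hy_meas
      (fun t ht => hwb t ht i) hq01 hy_range hc l hl0
  have hdn : ∀ i, μ {ω | s ≤ - S i ω} ≤ ENNReal.ofReal (Real.exp (-l)) := fun i => by
    have := tail_bound T hT ℱ (fun t ω => - w t ω i) q y (fun t ht => (hwi t ht i).neg) hq hy_meas
      (fun t ht ω => by rw [abs_neg]; exact hwb t ht i ω) hq01 hy_range hc l hl0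
    simp only [neg_mul, Finset.sum_neg_distrib] at this
    exact this
  let bad : Set Ω := ⋃ i, ({ω | s ≤ S i ω} ∪ {ω | s ≤ - S i ω})
  have hbad : μ bad ≤ ENNReal.ofReal ε := by
    calc μ bad ≤ ∑ i : Fin d, μ ({ω | s ≤ S i ω} ∪ {ω | s ≤ - S i ω}) :=
          measure_iUnion_fintype_le _ _
      _ ≤ ∑ i : Fin d, ENNReal.ofReal (ε / d) := by
          refine Finset.sum_le_sum fun i _ => ?_
          refine (measure_union_le _ _).trans ((add_le_add (hup i) (hdn i)).trans (le_of_eq ?_))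
          rw [← ENNReal.ofReal_add (Real.exp_pos _).le (Real.exp_pos _).le, hexp]
          congr 1
          field_simp
          norm_num
      _ = ENNReal.ofReal ε := by
          rw [Finset.sum_const, Finset.card_univ, Fintype.card_fin, nsmul_eq_mul,
            ← ENNReal.ofReal_natCast, ← ENNReal.ofReal_mul (by positivity)]
          congr 1
          field_simp
  have hae : ∀ᵐ ω ∂μ, ∀ t ∈ Finset.Icc 1 T, q t ω = g ⟪w t ω, θstar⟫ :=
    (ae_ball_iff (Finset.Icc 1 T).countable_toSet).2 hqg
  set G := {ω | ‖Δ ω‖ ≤ Real.sqrt (d * l / T)} with hG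
  have hcover : ∀ᵐ ω ∂μ, ω ∈ G ∪ bad := by
    filter_upwards [hae] with ω hω
    by_cases hb : ω ∈ bad
    · exact Or.inr hb
    left
    simp only [bad, Set.mem_iUnion, Set.mem_union, Set.mem_setOf_eq, not_exists, not_or,
      not_le] at hb
    have hcoord : ∀ i, Δ ω i = (T : ℝ)⁻¹ * S i ω := fun i => by
      rw [hΔ]
      simp only [PiLp.smul_apply, smul_eq_mul, WithLp.ofLp_sum, Finset.sum_apply, S]
      congr 1
      refine Finset.sum_congr rfl fun t ht => ?_
      rw [hω t ht]
      simp [mul_comm]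
    rw [hG, Set.mem_setOf_eq, EuclideanSpace.norm_eq]
    apply Real.sqrt_le_sqrt
    calc ∑ i, ‖Δ ω i‖ ^ 2 ≤ ∑ i : Fin d, l / T := by
          refine Finset.sum_le_sum fun i _ => ?_
          rw [Real.norm_eq_abs, sq_abs, hcoord, mul_pow]
          have h1 : S i ω ^ 2 ≤ s ^ 2 := sq_le_sq' (by linarith [(hb i).2]) (hb i).1.le
          rw [hss] at h1
          calc (T : ℝ)⁻¹ ^ 2 * S i ω ^ 2 ≤ (T : ℝ)⁻¹ ^ 2 * (T * l) := by gcongr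
            _ = l / T := by field_simp
      _ = d * l / T := by simp; ring
  have h1 : (1 : ℝ≥0∞) ≤ μ G + μ bad := by
    have : μ (G ∪ bad) = 1 := by
      rw [measure_congr ((Filter.eventuallyEq_univ (s := G ∪ bad)).2 hcover), measure_univ]
    rw [← this]
    exact measure_union_le _ _
  rw [ENNReal.ofReal_sub _ hε0.le, ENNReal.ofReal_one, tsub_le_iff_right]
  exact h1.trans (by gcongr)
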